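/- arXiv:2211.12381 — 2 statements merged into one kernel-verified Lean document; each statement's English description precedes it below -/
import Mathlib

section
/- In the tensor product F_p[x^{1/p^∞}] ⊗_{F_p[x]} F_p[x^{1/p^∞}], the element t := x^{1/p} ⊗ 1 − 1 ⊗ x^{1/p} satisfies t^p = 0 and t ≠ 0; in particular this tensor product is a non-reduced ring. -/
open scoped TensorProduct

/-- The additive monoid `M = ℤ[1/p]_{≥ 0}` of nonnegative rational numbers whose
denominator is a power of `p`, realized as an additive submonoid of `ℚ`. -/
def Mp (p : ℕ) : AddSubmonoid ℚ where
  carrier := {q | 0 ≤ q ∧ ∃ (k : ℕ) (m : ℤ), q * (p : ℚ) ^ k = m}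
  zero_mem' := ⟨le_refl 0, 0, 0, by norm_num⟩
  add_mem' := by
    rintro a b ⟨ha, k, m, hm⟩ ⟨hb, l, n, hn⟩
    refine ⟨add_nonneg ha hb, k + l, m * (p : ℤ) ^ l + n * (p : ℤ) ^ k, ?_⟩
    push_cast
    calc (a + b) * (p : ℚ) ^ (k + l)
        = (a * (p : ℚ) ^ k) * (p : ℚ) ^ l + (b * (p : ℚ) ^ l) * (p : ℚ) ^ k := by
          rw [pow_add]; ring
      _ = (m : ℚ) * (p : ℚ) ^ l + (n : ℚ) * (p : ℚ) ^ k := by rw [hm, hn]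

/-- `F_p[x^{1/p^∞}]`, the monoid algebra of `M` over `F_p = ZMod p`. -/
abbrev Rp (p : ℕ) : Type := AddMonoidAlgebra (ZMod p) (Mp p)

/-- The basis element `x^q` of `F_p[x^{1/p^∞}]`, for `q ∈ M`. -/
noncomputable def xe (p : ℕ) (q : Mp p) : Rp p := AddMonoidAlgebra.single q 1

/-- `1 ∈ M`. -/
def oneM (p : ℕ) : Mp p := ⟨1, zero_le_one, 0, 1, by norm_num⟩

/-- `1/p^k ∈ M`. -/
def pinvM (p : ℕ) (hp : p ≠ 0) (k : ℕ) : Mp p :=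
  ⟨1 / (p : ℚ) ^ k, by positivity, k, 1, by
    have hp' : (p : ℚ) ≠ 0 := Nat.cast_ne_zero.mpr hp
    field_simp
    norm_num⟩

/-- `F_p[x^{1/p^∞}]` as an `F_p[x]`-algebra via `x ↦ x^1`. -/
noncomputable instance (p : ℕ) : Algebra (Polynomial (ZMod p)) (Rp p) :=
  (Polynomial.aeval (xe p (oneM p))).toRingHom.toAlgebra

open Classical in
/-- The additive projection of `F_p[x^{1/p^∞}]` onto the span of the `x^q` with `q` an integer. -/
noncomputable def integralPart (p : ℕ) : Rp p →+ Rp p :=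
  AddMonoidAlgebra.liftNC (algebraMap (ZMod p) (Rp p)).toAddMonoidHom
    fun q => if ∃ n : ℤ, ((Multiplicative.toAdd q : Mp p) : ℚ) = n then
      xe p (Multiplicative.toAdd q) else 0

open Classical in
lemma integralPart_single (p : ℕ) (q : Mp p) (c : ZMod p) :
    integralPart p (AddMonoidAlgebra.single q c) =
      if ∃ n : ℤ, (q : ℚ) = n then AddMonoidAlgebra.single q c else 0 := by
  rw [integralPart, AddMonoidAlgebra.liftNC_single]
  by_cases h : ∃ n : ℤ, (q : ℚ) = n
  · simp [h, xe, AddMonoidAlgebra.single_mul_single]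
  · simp [h]

lemma integralPart_single_nsmul_oneM_add (p : ℕ) (q : Mp p) (c : ZMod p) (n : ℕ) :
    integralPart p (AddMonoidAlgebra.single (n • oneM p + q) c) =
      xe p (oneM p) ^ n * integralPart p (AddMonoidAlgebra.single q c) := by
  classical
  have key : (∃ m : ℤ, ((n • oneM p + q : Mp p) : ℚ) = m) ↔ ∃ m : ℤ, (q : ℚ) = m := by
    have hcoe : ((n • oneM p + q : Mp p) : ℚ) = n + q := by simp [oneM]
    rw [hcoe]
    constructor
    · rintro ⟨m, hm⟩
      exact ⟨m - n, by push_cast; linarith⟩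
    · rintro ⟨m, hm⟩
      exact ⟨n + m, by push_cast; linarith⟩
  rw [integralPart_single, integralPart_single]
  simp only [key]
  split_ifs
  · simp [xe, AddMonoidAlgebra.single_pow, AddMonoidAlgebra.single_mul_single]
  · simp

lemma polynomial_smul_def (p : ℕ) (f : Polynomial (ZMod p)) (a : Rp p) :
    f • a = Polynomial.aeval (xe p (oneM p)) f * a :=
  rfl

/-- `integralPart` as an `F_p[x]`-linear map. -/
noncomputable def integralPartLinear (p : ℕ) : Rp p →ₗ[Polynomial (ZMod p)] Rp p where
  __ := integralPart p
  map_smul' f a := by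
    simp only [polynomial_smul_def, RingHom.id_apply]
    change integralPart p _ = _ * integralPart p a
    induction f using Polynomial.induction_on' with
    | add f g hf hg => rw [map_add, add_mul, map_add, hf, hg, add_mul]
    | monomial n c =>
      induction a using AddMonoidAlgebra.induction_linear with
      | zero => simp
      | add a b ha hb => rw [mul_add, map_add, map_add, ha, hb, mul_add]
      | single q d =>
        have hmul (e : ZMod p) : algebraMap (ZMod p) (Rp p) c * AddMonoidAlgebra.single q e =
            AddMonoidAlgebra.single q (c * e) := by
          simp [AddMonoidAlgebra.single_mul_single]
        have hpart : integralPart p (AddMonoidAlgebra.single q (c * d)) =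
            algebraMap (ZMod p) (Rp p) c * integralPart p (AddMonoidAlgebra.single q d) := by
          classical
          rw [integralPart_single, integralPart_single]
          split_ifs
          · rw [hmul]
          · simp
        have hpow : xe p (oneM p) ^ n * AddMonoidAlgebra.single q (c * d) =
            AddMonoidAlgebra.single (n • oneM p + q) (c * d) := by
          simp [xe, AddMonoidAlgebra.single_pow, AddMonoidAlgebra.single_mul_single]
        rw [Polynomial.aeval_monomial, mul_right_comm, hmul, mul_comm, hpow,
          integralPart_single_nsmul_oneM_add, hpart]
        ring

lemma integralPart_xe_pinvM (p : ℕ) (hp : p.Prime) :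
    integralPart p (xe p (pinvM p hp.ne_zero 1)) = 0 := by
  classical
  rw [xe, integralPart_single, if_neg]
  rintro ⟨n, hn⟩
  have hp0 : (p : ℚ) ≠ 0 := Nat.cast_ne_zero.mpr hp.ne_zero
  have hn' : 1 / (p : ℚ) ^ 1 = n := hn
  rw [pow_one, div_eq_iff hp0] at hn'
  have hdvd : (p : ℤ) ∣ 1 := ⟨n, by rw [mul_comm]; exact_mod_cast hn'⟩
  exact hp.one_lt.ne' (by exact_mod_cast Int.eq_one_of_dvd_one (by positivity) hdvd)

lemma integralPart_one (p : ℕ) : integralPart p 1 = 1 := by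
  classical
  rw [AddMonoidAlgebra.one_def, integralPart_single, if_pos ⟨0, by simp⟩]

lemma xe_pinvM_pow (p : ℕ) (hp : p.Prime) :
    xe p (pinvM p hp.ne_zero 1) ^ p = algebraMap (Polynomial (ZMod p)) (Rp p) Polynomial.X := by
  have hp0 : (p : ℚ) ≠ 0 := Nat.cast_ne_zero.mpr hp.ne_zero
  have hsmul : p • pinvM p hp.ne_zero 1 = oneM p := by
    apply Subtype.ext
    simp [pinvM, oneM, hp0]
  have hX : algebraMap (Polynomial (ZMod p)) (Rp p) Polynomial.X = xe p (oneM p) :=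
    Polynomial.aeval_X _
  rw [hX, xe, AddMonoidAlgebra.single_pow, hsmul, one_pow, xe]

/-- in `F_p[x^{1/p^∞}] ⊗_{F_p[x]} F_p[x^{1/p^∞}]`, the element
`t = x^{1/p} ⊗ 1 − 1 ⊗ x^{1/p}` satisfies `t ^ p = 0` and `t ≠ 0`; so this tensor
product is a non-reduced ring. -/
theorem statement3 (p : ℕ) (hp : p.Prime) :
    ((xe p (pinvM p hp.ne_zero 1)) ⊗ₜ[Polynomial (ZMod p)] (1 : Rp p)
        - (1 : Rp p) ⊗ₜ[Polynomial (ZMod p)] (xe p (pinvM p hp.ne_zero 1))) ^ p = 0 ∧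
      ((xe p (pinvM p hp.ne_zero 1)) ⊗ₜ[Polynomial (ZMod p)] (1 : Rp p)
        - (1 : Rp p) ⊗ₜ[Polynomial (ZMod p)] (xe p (pinvM p hp.ne_zero 1))) ≠ 0 := by
  have : Fact p.Prime := ⟨hp⟩
  have hne : xe p (pinvM p hp.ne_zero 1) ⊗ₜ[Polynomial (ZMod p)] (1 : Rp p)
      - (1 : Rp p) ⊗ₜ[Polynomial (ZMod p)] xe p (pinvM p hp.ne_zero 1) ≠ 0 := by
    intro h
    have h' := congrArg (LinearMap.mul' (Polynomial (ZMod p)) (Rp p) ∘ₗ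
      (integralPartLinear p).rTensor (Rp p)) h
    have h₁ : integralPartLinear p (xe p (pinvM p hp.ne_zero 1)) = 0 := integralPart_xe_pinvM p hp
    have h₂ : integralPartLinear p 1 = 1 := integralPart_one p
    simp [h₁, h₂] at h'
    simp [xe] at h'
  refine ⟨?_, hne⟩
  have : Nontrivial (Rp p ⊗[Polynomial (ZMod p)] Rp p) := nontrivial_of_ne _ _ hne
  have : CharP (Rp p ⊗[Polynomial (ZMod p)] Rp p) p :=
    charP_of_injective_ringHom
      ((algebraMap (Polynomial (ZMod p)) (Rp p ⊗[Polynomial (ZMod p)] Rp p)).comp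
        Polynomial.C).injective p
  rw [sub_pow_char, Algebra.TensorProduct.tmul_pow, Algebra.TensorProduct.tmul_pow,
    xe_pinvM_pow p hp, one_pow, Algebra.algebraMap_eq_smul_one, TensorProduct.smul_tmul, sub_self]
end

section
/- There is an isomorphism of F_p-algebras Φ : F_p[x^{1/p^∞}] ⊗_{F_p} (F_p[y^{1/p^∞}]/(y)) → F_p[x^{1/p^∞}] ⊗_{F_p[x]} F_p[x^{1/p^∞}] such that Φ(x^q ⊗ 1) = x^q ⊗ 1 for all q ∈ M and Φ(1 ⊗ ȳ^{1/p^k}) = x^{1/p^k} ⊗ 1 − 1 ⊗ x^{1/p^k} for all k ∈ ℕ, where ȳ^{1/p^k} denotes the class of the basis element y^{1/p^k} in the quotient F_p[y^{1/p^∞}]/(y). -/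
open scoped TensorProduct

/-- The quotient ring `F_p[y^{1/p^∞}]/(y)`. -/
abbrev Ap (p : ℕ) : Type := Rp p ⧸ Ideal.span {xe p (oneM p)}

/-- The class `ȳ^q` of the basis element `y^q` in `F_p[y^{1/p^∞}]/(y)`. -/
noncomputable def ybar (p : ℕ) (q : Mp p) : Ap p :=
  Ideal.Quotient.mk (Ideal.span {xe p (oneM p)}) (xe p q)

instance (p : ℕ) : IsScalarTower (ZMod p) (Polynomial (ZMod p)) (Rp p) :=
  IsScalarTower.of_algebraMap_eq' (by
    rw [RingHom.algebraMap_toAlgebra]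
    exact ((Polynomial.aeval (xe p (oneM p))).comp_algebraMap).symm)

section PerfectPolynomialRing

variable {p : ℕ}

theorem sub_pow_char_of_zmod_algebra [Fact p.Prime] {S : Type*} [CommRing S] [Algebra (ZMod p) S]
    (a b : S) : (a - b) ^ p = a ^ p - b ^ p := by
  cases subsingleton_or_nontrivial S
  · exact Subsingleton.elim _ _
  · have : CharP S p := charP_of_injective_algebraMap (algebraMap (ZMod p) S).injective p
    exact sub_pow_char a b

theorem pow_pow_of_compatible_roots {S : Type*} [Monoid S] {s : ℕ → S}
    (hs : ∀ k, s (k + 1) ^ p = s k) (k l : ℕ) : s (k + l) ^ p ^ l = s k := by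
  induction l with
  | zero => simp
  | succ l ih => rw [pow_succ', pow_mul, ← add_assoc, hs, ih]

theorem pow_eq_pow_of_compatible_roots {S : Type*} [Monoid S] {s : ℕ → S}
    (hs : ∀ k, s (k + 1) ^ p = s k) {k l m n : ℕ} (h : m * p ^ l = n * p ^ k) :
    s k ^ m = s l ^ n := by
  rw [← pow_pow_of_compatible_roots hs k l, ← pow_pow_of_compatible_roots hs l k, ← pow_mul,
    ← pow_mul, add_comm l k, mul_comm, h, mul_comm]

theorem exists_nat_mul_pow_eq (q : Mp p) : ∃ k m : ℕ, (q : ℚ) * (p : ℚ) ^ k = m := by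
  obtain ⟨q, hq, k, m, hm⟩ := q
  have h : (0 : ℚ) ≤ m := hm ▸ by positivity
  lift m to ℕ using by exact_mod_cast h
  exact ⟨k, m, by simpa using hm⟩

/-- The value at `x ^ q` of the homomorphism sending `x ^ (1 / p ^ k)` to `s k`. -/
noncomputable def rootPow {S : Type*} [Monoid S] (s : ℕ → S) (q : Mp p) : S :=
  s (exists_nat_mul_pow_eq q).choose ^ (exists_nat_mul_pow_eq q).choose_spec.choose

theorem rootPow_eq {S : Type*} [Monoid S] {s : ℕ → S}
    (hs : ∀ k, s (k + 1) ^ p = s k) {q : Mp p} {k m : ℕ} (h : (q : ℚ) * (p : ℚ) ^ k = m) :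
    rootPow s q = s k ^ m := by
  have h_choose := (exists_nat_mul_pow_eq q).choose_spec.choose_spec
  refine pow_eq_pow_of_compatible_roots hs ?_
  rw [← Nat.cast_inj (R := ℚ)]
  push_cast
  rw [← h, ← h_choose]
  ring

/-- A compatible system of `p`-power roots in an `F_p`-algebra `S` defines a homomorphism
`F_p[x^{1/p^∞}] → S`. -/
noncomputable def liftRoots {S : Type*} [CommRing S] [Algebra (ZMod p) S] (s : ℕ → S)
    (hs : ∀ k, s (k + 1) ^ p = s k) : Rp p →ₐ[ZMod p] S :=
  AddMonoidAlgebra.lift (ZMod p) S (Mp p)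
    { toFun := fun q => rootPow s q.toAdd
      map_one' := by
        rw [rootPow_eq hs (k := 0) (m := 0) (by simp), pow_zero]
      map_mul' := fun a b => by
        obtain ⟨k, m, h⟩ := exists_nat_mul_pow_eq a.toAdd
        obtain ⟨l, n, h'⟩ := exists_nat_mul_pow_eq b.toAdd
        have ha : (a.toAdd : ℚ) * (p : ℚ) ^ (k + l) = (m * p ^ l : ℕ) := by
          rw [pow_add, ← mul_assoc, h]; push_cast; rfl
        have hb : (b.toAdd : ℚ) * (p : ℚ) ^ (k + l) = (n * p ^ k : ℕ) := by
          rw [add_comm, pow_add, ← mul_assoc, h']; push_cast; rfl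
        have hab : ((a * b).toAdd : ℚ) * (p : ℚ) ^ (k + l) = (m * p ^ l + n * p ^ k : ℕ) := by
          rw [Nat.cast_add, ← ha, ← hb, ← add_mul]; rfl
        rw [rootPow_eq hs ha, rootPow_eq hs hb, rootPow_eq hs hab, pow_add] }

theorem liftRoots_xe_pinvM (hp : p ≠ 0) {S : Type*} [CommRing S] [Algebra (ZMod p) S] (s : ℕ → S)
    (hs : ∀ k, s (k + 1) ^ p = s k) (k : ℕ) : liftRoots s hs (xe p (pinvM p hp k)) = s k := by
  have hp' : (p : ℚ) ≠ 0 := Nat.cast_ne_zero.mpr hp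
  have h : ((pinvM p hp k : Mp p) : ℚ) * (p : ℚ) ^ k = (1 : ℕ) := by
    simp [pinvM, hp']
  rw [liftRoots, xe, AddMonoidAlgebra.lift_single, one_smul]
  exact (rootPow_eq hs h).trans (pow_one _)

theorem xe_pow (q : Mp p) (n : ℕ) : xe p q ^ n = xe p (n • q) := by
  simp [xe, AddMonoidAlgebra.single_pow]

theorem xe_pinvM_succ_pow (hp : p ≠ 0) (k : ℕ) :
    xe p (pinvM p hp (k + 1)) ^ p = xe p (pinvM p hp k) := by
  have hp' : (p : ℚ) ≠ 0 := Nat.cast_ne_zero.mpr hp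
  rw [xe_pow]
  congr 1
  ext
  simp only [pinvM, AddSubmonoidClass.coe_nsmul, nsmul_eq_mul]
  field_simp
  ring

theorem pinvM_zero (hp : p ≠ 0) : pinvM p hp 0 = oneM p := by
  ext; simp [pinvM, oneM]

theorem algHom_ext_of_roots (hp : p ≠ 0) {S : Type*} [Semiring S] [Algebra (ZMod p) S]
    {f g : Rp p →ₐ[ZMod p] S}
    (h : ∀ k, f (xe p (pinvM p hp k)) = g (xe p (pinvM p hp k))) : f = g := by
  have hp' : (p : ℚ) ≠ 0 := Nat.cast_ne_zero.mpr hp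
  refine AddMonoidAlgebra.algHom_ext (fun q => ?_) (Subsingleton.elim _ _)
  obtain ⟨k, m, hq⟩ := (exists_nat_mul_pow_eq q)
  have hqm : q = m • pinvM p hp k := by
    ext
    simp only [pinvM, AddSubmonoidClass.coe_nsmul, nsmul_eq_mul, ← hq]
    field_simp
  change f (xe p q) = g (xe p q)
  rw [hqm, ← xe_pow, map_pow, map_pow, h]

theorem ybar_pinvM_succ_pow (hp : p ≠ 0) (k : ℕ) :
    ybar p (pinvM p hp (k + 1)) ^ p = ybar p (pinvM p hp k) := by
  rw [ybar, ← map_pow, xe_pinvM_succ_pow, ybar]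

theorem ybar_pinvM_zero (hp : p ≠ 0) : ybar p (pinvM p hp 0) = 0 := by
  rw [pinvM_zero]
  exact Ideal.Quotient.eq_zero_iff_mem.mpr (Ideal.mem_span_singleton_self _)

theorem algebraMap_X_Rp (hp : p ≠ 0) :
    algebraMap (Polynomial (ZMod p)) (Rp p) Polynomial.X = xe p (pinvM p hp 0) := by
  rw [pinvM_zero]
  exact Polynomial.aeval_X _

theorem xe_tmul_one_sub_one_tmul_xe_zero (hp : p ≠ 0) :
    xe p (pinvM p hp 0) ⊗ₜ[Polynomial (ZMod p)] (1 : Rp p)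
      - (1 : Rp p) ⊗ₜ[Polynomial (ZMod p)] xe p (pinvM p hp 0) = 0 := by
  rw [← algebraMap_X_Rp hp, Algebra.algebraMap_eq_smul_one, TensorProduct.smul_tmul, sub_self]

theorem xe_tmul_one_sub_one_tmul_xe_succ_pow (hp : p.Prime) (k : ℕ) :
    (xe p (pinvM p hp.ne_zero (k + 1)) ⊗ₜ[Polynomial (ZMod p)] (1 : Rp p)
      - (1 : Rp p) ⊗ₜ[Polynomial (ZMod p)] xe p (pinvM p hp.ne_zero (k + 1))) ^ p
      = xe p (pinvM p hp.ne_zero k) ⊗ₜ[Polynomial (ZMod p)] (1 : Rp p)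
        - (1 : Rp p) ⊗ₜ[Polynomial (ZMod p)] xe p (pinvM p hp.ne_zero k) := by
  have := Fact.mk hp
  rw [sub_pow_char_of_zmod_algebra, Algebra.TensorProduct.tmul_pow,
    Algebra.TensorProduct.tmul_pow, xe_pinvM_succ_pow, one_pow]

/-- The homomorphism `F_p[y^{1/p^∞}]/(y) → F_p[x^{1/p^∞}] ⊗_{F_p[x]} F_p[x^{1/p^∞}]` sending
`y^{1/p^k}` to `x^{1/p^k} ⊗ 1 − 1 ⊗ x^{1/p^k}`. -/
noncomputable def differenceHom (hp : p.Prime) :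
    Ap p →ₐ[ZMod p] Rp p ⊗[Polynomial (ZMod p)] Rp p :=
  Ideal.Quotient.liftₐ _
    (liftRoots
      (fun k => xe p (pinvM p hp.ne_zero k) ⊗ₜ[Polynomial (ZMod p)] (1 : Rp p)
        - (1 : Rp p) ⊗ₜ[Polynomial (ZMod p)] xe p (pinvM p hp.ne_zero k))
      (xe_tmul_one_sub_one_tmul_xe_succ_pow hp))
    (fun a ha => by
      obtain ⟨b, rfl⟩ := Ideal.mem_span_singleton'.mp ha
      rw [map_mul, ← pinvM_zero hp.ne_zero, liftRoots_xe_pinvM,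
        xe_tmul_one_sub_one_tmul_xe_zero, mul_zero])

theorem differenceHom_ybar (hp : p.Prime) (k : ℕ) :
    differenceHom hp (ybar p (pinvM p hp.ne_zero k))
      = xe p (pinvM p hp.ne_zero k) ⊗ₜ[Polynomial (ZMod p)] (1 : Rp p)
        - (1 : Rp p) ⊗ₜ[Polynomial (ZMod p)] xe p (pinvM p hp.ne_zero k) :=
  liftRoots_xe_pinvM hp.ne_zero
    (fun k => xe p (pinvM p hp.ne_zero k) ⊗ₜ[Polynomial (ZMod p)] (1 : Rp p)
      - (1 : Rp p) ⊗ₜ[Polynomial (ZMod p)] xe p (pinvM p hp.ne_zero k))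
    (xe_tmul_one_sub_one_tmul_xe_succ_pow hp) k

section Translate

variable {A : Type*} [CommRing A] [Algebra (ZMod p) A] {y : ℕ → A}

theorem xe_tmul_one_sub_one_tmul_succ_pow (hp : p.Prime) (hy : ∀ k, y (k + 1) ^ p = y k) (k : ℕ) :
    (xe p (pinvM p hp.ne_zero (k + 1)) ⊗ₜ[ZMod p] (1 : A) - (1 : Rp p) ⊗ₜ[ZMod p] y (k + 1)) ^ p
      = xe p (pinvM p hp.ne_zero k) ⊗ₜ[ZMod p] (1 : A) - (1 : Rp p) ⊗ₜ[ZMod p] y k := by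
  have := Fact.mk hp
  rw [sub_pow_char_of_zmod_algebra, Algebra.TensorProduct.tmul_pow,
    Algebra.TensorProduct.tmul_pow, xe_pinvM_succ_pow, hy, one_pow, one_pow]

/-- For a compatible system `y` of `p`-power roots in `A`, the `F_p`-algebra homomorphism
`F_p[x^{1/p^∞}] → F_p[x^{1/p^∞}] ⊗ A` sending `x^{1/p^k}` to `x^{1/p^k} ⊗ 1 − 1 ⊗ y k`. -/
noncomputable def translateHom (hp : p.Prime) (hy : ∀ k, y (k + 1) ^ p = y k) :
    Rp p →ₐ[ZMod p] Rp p ⊗[ZMod p] A :=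
  liftRoots
    (fun k => xe p (pinvM p hp.ne_zero k) ⊗ₜ[ZMod p] (1 : A) - (1 : Rp p) ⊗ₜ[ZMod p] y k)
    (xe_tmul_one_sub_one_tmul_succ_pow hp hy)

theorem translateHom_xe (hp : p.Prime) (hy : ∀ k, y (k + 1) ^ p = y k) (k : ℕ) :
    translateHom hp hy (xe p (pinvM p hp.ne_zero k))
      = xe p (pinvM p hp.ne_zero k) ⊗ₜ[ZMod p] (1 : A) - (1 : Rp p) ⊗ₜ[ZMod p] y k :=
  liftRoots_xe_pinvM hp.ne_zero
    (fun k => xe p (pinvM p hp.ne_zero k) ⊗ₜ[ZMod p] (1 : A) - (1 : Rp p) ⊗ₜ[ZMod p] y k)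
    (xe_tmul_one_sub_one_tmul_succ_pow hp hy) k

theorem translateHom_algebraMap (hp : p.Prime) (hy : ∀ k, y (k + 1) ^ p = y k) (hy₀ : y 0 = 0)
    (f : Polynomial (ZMod p)) :
    translateHom hp hy (algebraMap (Polynomial (ZMod p)) (Rp p) f)
      = algebraMap (Polynomial (ZMod p)) (Rp p ⊗[ZMod p] A) f := by
  have h : (translateHom hp hy).comp
        (IsScalarTower.toAlgHom (ZMod p) (Polynomial (ZMod p)) (Rp p))
      = (Algebra.TensorProduct.includeLeft : Rp p →ₐ[ZMod p] Rp p ⊗[ZMod p] A).comp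
        (IsScalarTower.toAlgHom (ZMod p) (Polynomial (ZMod p)) (Rp p)) := by
    refine Polynomial.algHom_ext ?_
    simp only [AlgHom.comp_apply, IsScalarTower.coe_toAlgHom',
      algebraMap_X_Rp hp.ne_zero, translateHom_xe, hy₀, TensorProduct.tmul_zero,
      sub_zero, Algebra.TensorProduct.includeLeft_apply]
  exact DFunLike.congr_fun h f

/-- The extension of `translateHom` to `F_p[x^{1/p^∞}] ⊗_{F_p[x]} F_p[x^{1/p^∞}]` by the left
inclusion. -/
noncomputable def translateMap (hp : p.Prime) (hy : ∀ k, y (k + 1) ^ p = y k) (hy₀ : y 0 = 0) :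
    Rp p ⊗[Polynomial (ZMod p)] Rp p →ₐ[ZMod p] Rp p ⊗[ZMod p] A :=
  (Algebra.TensorProduct.lift
    (Algebra.TensorProduct.includeLeft : Rp p →ₐ[Polynomial (ZMod p)] Rp p ⊗[ZMod p] A)
    ({ translateHom hp hy with commutes' := translateHom_algebraMap hp hy hy₀ } :
      Rp p →ₐ[Polynomial (ZMod p)] Rp p ⊗[ZMod p] A)
    (fun _ _ => Commute.all _ _)).restrictScalars (ZMod p)

/-- If `A` is generated by a compatible system `y` of `p`-power roots with `y 0 = 0`, and `D` sends
`y k` to `x^{1/p^k} ⊗ 1 − 1 ⊗ x^{1/p^k}`, then `D` extends to an isomorphism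
`F_p[x^{1/p^∞}] ⊗ A ≃ F_p[x^{1/p^∞}] ⊗_{F_p[x]} F_p[x^{1/p^∞}]`. -/
theorem exists_algEquiv_of_compatible_roots (hp : p.Prime) (hy : ∀ k, y (k + 1) ^ p = y k)
    (hy₀ : y 0 = 0) (D : A →ₐ[ZMod p] Rp p ⊗[Polynomial (ZMod p)] Rp p)
    (hD : ∀ k, D (y k) = xe p (pinvM p hp.ne_zero k) ⊗ₜ[Polynomial (ZMod p)] (1 : Rp p)
      - (1 : Rp p) ⊗ₜ[Polynomial (ZMod p)] xe p (pinvM p hp.ne_zero k))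
    (hext : ∀ f g : A →ₐ[ZMod p] Rp p ⊗[ZMod p] A, (∀ k, f (y k) = g (y k)) → f = g) :
    ∃ Φ : (Rp p ⊗[ZMod p] A) ≃ₐ[ZMod p] (Rp p ⊗[Polynomial (ZMod p)] Rp p),
      ∀ a b, Φ (a ⊗ₜ b) = a ⊗ₜ 1 * D b := by
  let F : Rp p ⊗[ZMod p] A →ₐ[ZMod p] Rp p ⊗[Polynomial (ZMod p)] Rp p :=
    Algebra.TensorProduct.lift
      (Algebra.TensorProduct.includeLeft : Rp p →ₐ[ZMod p] Rp p ⊗[Polynomial (ZMod p)] Rp p)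
      D (fun _ _ => Commute.all _ _)
  have hF (a b) : F (a ⊗ₜ b) = a ⊗ₜ 1 * D b := rfl
  let T := translateMap hp hy hy₀
  have hT (a b) : T (a ⊗ₜ b) = a ⊗ₜ 1 * translateHom hp hy b := rfl
  have hTD : T.comp D = Algebra.TensorProduct.includeRight := by
    refine hext _ _ fun k => ?_
    rw [AlgHom.comp_apply, Algebra.TensorProduct.includeRight_apply, hD, map_sub, hT, hT,
      translateHom_xe, map_one, mul_one, ← Algebra.TensorProduct.one_def, one_mul, sub_sub_cancel]
  have hFT : F.comp (translateHom hp hy) = (Algebra.TensorProduct.includeRight :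
      Rp p →ₐ[Polynomial (ZMod p)] Rp p ⊗[Polynomial (ZMod p)] Rp p).restrictScalars
        (ZMod p) := by
    refine algHom_ext_of_roots hp.ne_zero fun k => ?_
    rw [AlgHom.comp_apply, AlgHom.restrictScalars_apply, Algebra.TensorProduct.includeRight_apply,
      translateHom_xe, map_sub, hF, hF, hD, map_one, mul_one, ← Algebra.TensorProduct.one_def,
      one_mul, sub_sub_cancel]
  have hleft (z) : T (F z) = z := by
    induction z with
    | zero => simp only [map_zero]
    | add z w hz hw => rw [map_add, map_add, hz, hw]
    | tmul a b =>
      have h : T (D b) = 1 ⊗ₜ b := DFunLike.congr_fun hTD b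
      rw [hF, map_mul, h, hT, map_one, mul_one, Algebra.TensorProduct.tmul_mul_tmul, mul_one,
        one_mul]
  have hright (z) : F (T z) = z := by
    induction z with
    | zero => simp only [map_zero]
    | add z w hz hw => rw [map_add, map_add, hz, hw]
    | tmul a b =>
      have h : F (translateHom hp hy b) = 1 ⊗ₜ b := DFunLike.congr_fun hFT b
      rw [hT, map_mul, h, hF, map_one, mul_one, Algebra.TensorProduct.tmul_mul_tmul, mul_one,
        one_mul]
  exact ⟨AlgEquiv.ofAlgHom F T (AlgHom.ext hright) (AlgHom.ext hleft), hF⟩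

end Translate

end PerfectPolynomialRing

/-- there is an `F_p`-algebra isomorphism
`Φ : F_p[x^{1/p^∞}] ⊗_{F_p} (F_p[y^{1/p^∞}]/(y)) ≃ F_p[x^{1/p^∞}] ⊗_{F_p[x]} F_p[x^{1/p^∞}]`
with `Φ(x^q ⊗ 1) = x^q ⊗ 1` for all `q ∈ M` and
`Φ(1 ⊗ ȳ^{1/p^k}) = x^{1/p^k} ⊗ 1 − 1 ⊗ x^{1/p^k}` for all `k ∈ ℕ`. -/
theorem statement4 (p : ℕ) (hp : p.Prime) :
    ∃ Φ : (Rp p ⊗[ZMod p] Ap p) ≃ₐ[ZMod p] (Rp p ⊗[Polynomial (ZMod p)] Rp p),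
      (∀ q : Mp p, Φ ((xe p q) ⊗ₜ[ZMod p] (1 : Ap p))
          = (xe p q) ⊗ₜ[Polynomial (ZMod p)] (1 : Rp p)) ∧
      (∀ k : ℕ, Φ ((1 : Rp p) ⊗ₜ[ZMod p] ybar p (pinvM p hp.ne_zero k))
          = (xe p (pinvM p hp.ne_zero k)) ⊗ₜ[Polynomial (ZMod p)] (1 : Rp p)
            - (1 : Rp p) ⊗ₜ[Polynomial (ZMod p)] (xe p (pinvM p hp.ne_zero k))) := by
  obtain ⟨Φ, hΦ⟩ := exists_algEquiv_of_compatible_roots hp (ybar_pinvM_succ_pow hp.ne_zero)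
    (ybar_pinvM_zero hp.ne_zero) (differenceHom hp) (differenceHom_ybar hp)
    (fun f g h => Ideal.Quotient.algHom_ext _ (algHom_ext_of_roots hp.ne_zero h))
  refine ⟨Φ, fun q => ?_, fun k => ?_⟩
  · rw [hΦ, map_one, mul_one]
  · rw [hΦ, ← Algebra.TensorProduct.one_def, one_mul, differenceHom_ybar]
end
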